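/- If G is a connected finite simple graph of order n, then 2·ι_g'(G) ≤ n (that is, the Staller-start game isolation number is at most half the order). -/

import Mathlib

open SimpleGraph

variable {V : Type*}

/-- The closed neighborhood `N_G[X]` of a set `X` of vertices: all vertices that are in `X`
or adjacent to a vertex of `X`. -/
def closedNbhdSet (G : SimpleGraph V) (X : Set V) : Set V :=
  {u | u ∈ X ∨ ∃ x ∈ X, G.Adj x u}

/-- A vertex `v` is playable with respect to the set `X` of already selected vertices if the
closed neighborhood of `v` contains a vertex `u ∉ N_G[X]` having a neighbor `w ∉ N_G[X]`,
i.e. `v` dominates a vertex of a nontrivial component of `G - N_G[X]`. -/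
def IsPlayable (G : SimpleGraph V) (X : Set V) (v : V) : Prop :=
  ∃ u, (u = v ∨ G.Adj v u) ∧ u ∉ closedNbhdSet G X ∧
    ∃ w, G.Adj u w ∧ w ∉ closedNbhdSet G X

open Classical in
/-- The optimal-play value (number of further selected vertices) of the isolation game
position with given fuel, player to move (`true` = Dominator, the minimizer;
`false` = Staller, the maximizer) and set `X` of already selected vertices. -/
noncomputable def isoGameVal (G : SimpleGraph V) : ℕ → Bool → Set V → ℕ
  | 0, _, _ => 0
  | (k + 1), isDom, X =>
    if ∃ v, IsPlayable G X v then
      (if isDom then sInf else sSup)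
        {n : ℕ | ∃ v, IsPlayable G X v ∧ n = isoGameVal G k (!isDom) (insert v X) + 1}
    else 0

/-- The game isolation number `ι_g(G)`: the number of vertices selected in the isolation
game on `G` when Dominator moves first and both players play optimally.  (A game on a
graph with `n` vertices lasts at most `n` moves, so fuel `Fintype.card V` suffices.) -/
noncomputable def iotaGame (G : SimpleGraph V) [Fintype V] : ℕ :=
  isoGameVal G (Fintype.card V) true ∅

/-- The Staller-start game isolation number `ι_g'(G)`: the number of vertices selected in
the isolation game on `G` when Staller moves first and both players play optimally. -/
noncomputable def iotaGame' (G : SimpleGraph V) [Fintype V] : ℕ :=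
  isoGameVal G (Fintype.card V) false ∅

/-- The vertices outside `N_G[X]` with a neighbor outside `N_G[X]`, i.e. the vertices of the
nontrivial components of `G - N_G[X]`. -/
def activeSet (G : SimpleGraph V) (X : Set V) : Set V :=
  {u | u ∉ closedNbhdSet G X ∧ ∃ w, G.Adj u w ∧ w ∉ closedNbhdSet G X}

theorem closedNbhdSet_mono (G : SimpleGraph V) {X Y : Set V} (h : X ⊆ Y) :
    closedNbhdSet G X ⊆ closedNbhdSet G Y := by
  rintro u (hu | ⟨x, hx, hxu⟩)
  · exact Or.inl (h hu)
  · exact Or.inr ⟨x, h hx, hxu⟩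

theorem activeSet_anti (G : SimpleGraph V) {X Y : Set V} (h : X ⊆ Y) :
    activeSet G Y ⊆ activeSet G X := by
  rintro u ⟨hu, w, huw, hw⟩
  exact ⟨fun h' => hu (closedNbhdSet_mono G h h'), w, huw,
    fun h' => hw (closedNbhdSet_mono G h h')⟩

theorem mem_closedNbhdSet_insert (G : SimpleGraph V) (X : Set V) {u v : V}
    (h : u = v ∨ G.Adj v u) : u ∈ closedNbhdSet G (insert v X) := by
  rcases h with rfl | h
  · exact Or.inl (Set.mem_insert _ _)
  · exact Or.inr ⟨v, Set.mem_insert _ _, h⟩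

theorem ncard_activeSet_insert_add_le [Finite V] (G : SimpleGraph V) (X S : Set V) (v : V)
    (hS : S ⊆ activeSet G X) (hd : ∀ s ∈ S, s ∉ activeSet G (insert v X)) :
    (activeSet G (insert v X)).ncard + S.ncard ≤ (activeSet G X).ncard := by
  rw [← Set.ncard_union_eq (Set.disjoint_left.2 fun s h h' => hd s h' h)]
  exact Set.ncard_le_ncard (Set.union_subset (activeSet_anti G (Set.subset_insert _ _)) hS)

theorem IsPlayable.ncard_activeSet_insert_lt [Finite V] {G : SimpleGraph V} {X : Set V} {v : V}
    (h : IsPlayable G X v) :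
    (activeSet G (insert v X)).ncard + 1 ≤ (activeSet G X).ncard := by
  obtain ⟨u, huv, hu, w, huw, hw⟩ := h
  rw [← Set.ncard_singleton u]
  refine ncard_activeSet_insert_add_le G X {u} v ?_ ?_
  · rintro _ rfl
    exact ⟨hu, w, huw, hw⟩
  · rintro _ rfl h
    exact h.1 (mem_closedNbhdSet_insert G X huv)

theorem isoGameVal_dominator_le {G : SimpleGraph V} {X : Set V} {v : V} (k : ℕ)
    (h : IsPlayable G X v) :
    isoGameVal G (k + 1) true X ≤ isoGameVal G k false (insert v X) + 1 := by
  rw [isoGameVal, if_pos ⟨v, h⟩, if_pos rfl]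
  exact Nat.sInf_le ⟨v, h, rfl⟩

theorem isoGameVal_staller_le {G : SimpleGraph V} {X : Set V} {k m : ℕ}
    (h : ∀ v, IsPlayable G X v → isoGameVal G k true (insert v X) + 1 ≤ m) :
    isoGameVal G (k + 1) false X ≤ m := by
  rw [isoGameVal]
  split_ifs with hp h'
  · cases h'
  · obtain ⟨v, hv⟩ := hp
    refine csSup_le ⟨_, v, hv, rfl⟩ ?_
    rintro n ⟨w, hw, rfl⟩
    exact h w hw
  · exact Nat.zero_le _

theorem isoGameVal_eq_zero {G : SimpleGraph V} {X : Set V} (k : ℕ) (b : Bool)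
    (h : ¬ ∃ v, IsPlayable G X v) : isoGameVal G k b X = 0 := by
  cases k with
  | zero => rw [isoGameVal]
  | succ k => rw [isoGameVal, if_neg h]

/-- If all nontrivial components of `G - N_G[X]` are single edges, every move removes an edge. -/
theorem two_mul_isoGameVal_le_of_matching [Finite V] (G : SimpleGraph V) (k : ℕ) (b : Bool)
    (X : Set V)
    (hX : ∀ u w w', u ∉ closedNbhdSet G X → w ∉ closedNbhdSet G X → w' ∉ closedNbhdSet G X →
      G.Adj u w → G.Adj u w' → w = w') :
    2 * isoGameVal G k b X ≤ (activeSet G X).ncard := by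
  induction k generalizing b X with
  | zero => simp [isoGameVal]
  | succ k ih =>
    have step : ∀ b v, IsPlayable G X v →
        2 * (isoGameVal G k b (insert v X) + 1) ≤ (activeSet G X).ncard := by
      rintro b v ⟨u, huv, hu, w, huw, hw⟩
      have hsub := closedNbhdSet_mono G (Set.subset_insert v X)
      have hrec := ih b (insert v X) fun a c c' ha hc hc' =>
        hX a c c' (fun h => ha (hsub h)) (fun h => hc (hsub h)) (fun h => hc' (hsub h))
      have hdrop := ncard_activeSet_insert_add_le G X {u, w} v
        (by
          rintro _ (rfl | rfl)
          · exact ⟨hu, w, huw, hw⟩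
          · exact ⟨hw, u, huw.symm, hu⟩)
        (by
          have hmem := mem_closedNbhdSet_insert G X huv
          rintro _ (rfl | rfl)
          · exact fun h => h.1 hmem
          · rintro ⟨_, x, hwx, hx⟩
            exact hx (hX _ u x hw hu (fun h => hx (hsub h)) huw.symm hwx ▸ hmem))
      rw [Set.ncard_pair huw.ne] at hdrop
      omega
    by_cases hp : ∃ v, IsPlayable G X v
    · cases b with
      | true =>
        obtain ⟨v, hv⟩ := hp
        have := isoGameVal_dominator_le k hv
        have := step false v hv
        omega
      | false =>
        have : isoGameVal G (k + 1) false X ≤ (activeSet G X).ncard / 2 :=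
          isoGameVal_staller_le fun v hv => by
            have := step true v hv
            omega
        omega
    · rw [isoGameVal_eq_zero _ _ hp]
      omega

/-- With Dominator to move, at most half of the active vertices are selected. -/
theorem two_mul_isoGameVal_dominator_le [Finite V] (G : SimpleGraph V) (k : ℕ) (X : Set V) :
    2 * isoGameVal G k true X ≤ (activeSet G X).ncard := by
  induction k using Nat.strong_induction_on generalizing X with
  | _ k ih =>
  by_cases hX : ∀ u w w', u ∉ closedNbhdSet G X → w ∉ closedNbhdSet G X →
      w' ∉ closedNbhdSet G X → G.Adj u w → G.Adj u w' → w = w'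
  · exact two_mul_isoGameVal_le_of_matching G k true X hX
  push Not at hX
  obtain ⟨u, w, w', hu, hw, hw', huw, huw', hne⟩ := hX
  have hdrop := ncard_activeSet_insert_add_le G X {u, w, w'} u
    (by
      rintro _ (rfl | rfl | rfl)
      · exact ⟨hu, w, huw, hw⟩
      · exact ⟨hw, u, huw.symm, hu⟩
      · exact ⟨hw', u, huw'.symm, hu⟩)
    (by
      rintro _ (rfl | rfl | rfl) h
      · exact h.1 (mem_closedNbhdSet_insert G X (Or.inl rfl))
      · exact h.1 (mem_closedNbhdSet_insert G X (Or.inr huw))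
      · exact h.1 (mem_closedNbhdSet_insert G X (Or.inr huw')))
  rw [Set.ncard_eq_three.2 ⟨u, w, w', huw.ne, huw'.ne, hne, rfl⟩] at hdrop
  match k, ih with
  | 0, _ => simp [isoGameVal]
  | k + 1, ih =>
    have hdom := isoGameVal_dominator_le k (v := u) ⟨u, Or.inl rfl, hu, w, huw, hw⟩
    suffices isoGameVal G k false (insert u X) ≤ ((activeSet G X).ncard - 2) / 2 by omega
    match k, ih with
    | 0, _ => simp [isoGameVal]
    | k + 1, ih =>
      refine isoGameVal_staller_le fun v hv => ?_
      have := ih k (by omega) (insert v (insert u X))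
      have := hv.ncard_activeSet_insert_lt
      omega

/-- If `G` is a connected finite graph of order `n`, then `ι_g'(G) ≤ n/2`. -/
theorem stallerStart_game_isolation_half_bound {V : Type*} [Fintype V] (G : SimpleGraph V)
    (hG : G.Connected) :
    2 * iotaGame' G ≤ Fintype.card V := by
  suffices ∀ k, isoGameVal G k false ∅ ≤ Fintype.card V / 2 by
    have := this (Fintype.card V)
    rw [iotaGame']
    omega
  rintro (_ | k)
  · simp [isoGameVal]
  refine isoGameVal_staller_le fun v hv => ?_
  obtain ⟨x, hx⟩ : ∃ x, G.Adj v x := by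
    obtain ⟨u, rfl | h, -, w, huw, -⟩ := hv
    exacts [⟨w, huw⟩, ⟨u, h⟩]
  have hval := two_mul_isoGameVal_dominator_le G k (insert v ∅)
  have hsub : ({v, x} : Set V) ⊆ activeSet G ∅ := by
    rintro _ (rfl | rfl)
    · exact ⟨by simp [closedNbhdSet], x, hx, by simp [closedNbhdSet]⟩
    · exact ⟨by simp [closedNbhdSet], v, hx.symm, by simp [closedNbhdSet]⟩
  have hdrop := ncard_activeSet_insert_add_le G ∅ {v, x} v hsub (by
    rintro _ (rfl | rfl) h
    · exact h.1 (mem_closedNbhdSet_insert G ∅ (Or.inl rfl))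
    · exact h.1 (mem_closedNbhdSet_insert G ∅ (Or.inr hx)))
  rw [Set.ncard_pair hx.ne] at hdrop
  have hcard : (activeSet G ∅).ncard ≤ Fintype.card V := by
    rw [← Nat.card_eq_fintype_card]
    exact Set.ncard_le_card _
  omega
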